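/- arXiv:1101.5641 — 4 statements merged into one kernel-verified Lean document; each statement's English description precedes it below -/
import Mathlib

section
/- The graph R_20 is Class 0; that is, π(R_20) = 20. -/
open Finset SimpleGraph

variable {V : Type*}

/-- A single pebbling move: remove two pebbles from `u` and add one pebble to a
neighbor `v`. -/
def PebblingMove (G : SimpleGraph V) (C C' : V → ℕ) : Prop :=
  ∃ u v : V, G.Adj u v ∧ 2 ≤ C u ∧
    C' u = C u - 2 ∧ C' v = C v + 1 ∧ ∀ x : V, x ≠ u → x ≠ v → C' x = C x

/-- A configuration `C` is `r`-solvable if some finite sequence of pebbling moves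
starting from `C` yields a configuration with at least one pebble on `r`. -/
def PebblingSolvable (G : SimpleGraph V) (r : V) (C : V → ℕ) : Prop :=
  ∃ C' : V → ℕ, Relation.ReflTransGen (PebblingMove G) C C' ∧ 1 ≤ C' r

/-- `piVertex G r` is the least `t` such that every configuration of size `t`
is `r`-solvable. -/
noncomputable def piVertex [Fintype V] (G : SimpleGraph V) (r : V) : ℕ :=
  sInf {t : ℕ | ∀ C : V → ℕ, (∑ v, C v) = t → PebblingSolvable G r C}

/-- The pebbling number `π(G) = max_r π(G,r)`. -/
noncomputable def pebblingNumber [Fintype V] (G : SimpleGraph V) : ℕ :=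
  Finset.univ.sup (fun r => piVertex G r)

/-- A (basic) strategy rooted at `r`: a subtree `T` of `G` containing `r` with
at least two vertices, together with a nonnegative, nonzero weight function `w`
vanishing off `T` and at `r`, with `w(v⁺) = 2·w(v)` for every vertex `v` of `T`
other than `r` and the children of `r`, where `v⁺` is the parent of `v`, i.e.
the neighbor of `v` on the path in `T` from `v` to `r`. -/
structure Strategy (G : SimpleGraph V) (r : V) where
  T : G.Subgraph
  w : V → ℚ
  root_mem : r ∈ T.verts
  two_le_ncard : 2 ≤ T.verts.ncard
  isTree : T.coe.IsTree
  w_nonneg : ∀ v, 0 ≤ w v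
  w_ne_zero : w ≠ 0
  w_outside : ∀ v, v ∉ T.verts → w v = 0
  w_root : w r = 0
  w_parent : ∀ u v : T.verts, T.coe.Adj u v → (v : V) ≠ r → ¬ T.Adj r (v : V) →
    T.coe.dist u ⟨r, root_mem⟩ < T.coe.dist v ⟨r, root_mem⟩ → w (u : V) = 2 * w (v : V)

/-- `w(C) = ∑_{v ∈ V(G)} w(v)·C(v)`. -/
noncomputable def configWeight [Fintype V] {G : SimpleGraph V} {r : V}
    (S : Strategy G r) (C : V → ℕ) : ℚ :=
  ∑ v, S.w v * (C v : ℚ)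

open Classical in
/-- `w(𝐓) = ∑_{v ∈ V(T), v ≠ r} w(v)`. -/
noncomputable def treeWeight [Fintype V] {G : SimpleGraph V} {r : V} (S : Strategy G r) : ℚ :=
  ∑ v ∈ Finset.univ.filter (fun v => v ∈ S.T.verts ∧ v ≠ r), S.w v

/-- The edges of the random graph `R_20`, with `v_i` represented by `i - 1 : Fin 20`. -/
def r20Edges : List (Fin 20 × Fin 20) :=
  [(0,5), (0,7), (0,10), (0,11), (0,13), (0,14), (0,15), (0,16),
   (1,3), (1,4), (1,5), (1,6), (1,7), (1,9), (1,14), (1,15), (1,16), (1,17), (1,18), (1,19),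
   (2,3), (2,5), (2,7), (2,11), (2,13), (2,19),
   (3,4), (3,5), (3,7), (3,8), (3,11), (3,14), (3,17), (3,18),
   (4,6), (4,11), (4,13), (4,14), (4,15), (4,17), (4,19),
   (5,6), (5,7), (5,13), (5,14), (5,18),
   (6,7), (6,10), (6,11), (6,12), (6,13), (6,14), (6,16), (6,17),
   (7,9), (7,10), (7,13), (7,14), (7,16),
   (8,9), (8,10), (8,12), (8,13), (8,16), (8,18), (8,19),
   (9,15), (9,17), (9,18), (9,19),
   (10,12), (10,13), (10,15), (10,17), (10,19),
   (11,12), (11,15),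
   (12,18), (12,19),
   (13,17),
   (14,18),
   (15,17), (15,19),
   (16,18),
   (17,19),
   (18,19)]

/-- The random graph `R_20`. -/
def R20 : SimpleGraph (Fin 20) :=
  SimpleGraph.fromRel (fun i j => (i, j) ∈ r20Edges)

section WeightFunctions

variable {G : SimpleGraph V} {r : V}

theorem PebblingSolvable.of_pebblingMove {C C' : V → ℕ} (hm : PebblingMove G C C')
    (h : PebblingSolvable G r C') : PebblingSolvable G r C :=
  let ⟨D, hD, hr⟩ := h
  ⟨D, .head hm hD, hr⟩

theorem pebblingMove_update [DecidableEq V] {C : V → ℕ} {u v : V} (huv : G.Adj u v)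
    (hu : 2 ≤ C u) :
    PebblingMove G C (Function.update (Function.update C u (C u - 2)) v (C v + 1)) :=
  ⟨u, v, huv, hu, by simp [huv.ne], by simp, fun x hxu hxv => by simp [hxu, hxv]⟩

/-- A weight function for the root `r`: the weight vanishes at `r`, and every vertex of positive
weight is adjacent to `r` or to a vertex of at least twice its weight. -/
def IsWeightFunction (G : SimpleGraph V) (r : V) (w : V → ℕ) : Prop :=
  w r = 0 ∧ ∀ v, w v ≠ 0 → G.Adj v r ∨ ∃ p, G.Adj v p ∧ 2 * w v ≤ w p

theorem sum_mul_update_update [Fintype V] [DecidableEq V] (w C : V → ℕ) {u v : V} (huv : u ≠ v)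
    (hu : 2 ≤ C u) :
    ∑ x, w x * Function.update (Function.update C u (C u - 2)) v (C v + 1) x + 2 * w u =
      ∑ x, w x * C x + w v := by
  have h (f : V → ℕ) : ∑ x, f x = f u + (f v + ∑ x ∈ (univ.erase u).erase v, f x) := by
    rw [add_sum_erase _ f (by simp [huv.symm]), add_sum_erase _ f (mem_univ u)]
  rw [h, h (fun x => w x * C x)]
  have hrest : ∑ x ∈ (univ.erase u).erase v,
      w x * Function.update (Function.update C u (C u - 2)) v (C v + 1) x =
      ∑ x ∈ (univ.erase u).erase v, w x * C x := by
    refine sum_congr rfl fun x hx => ?_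
    simp only [mem_erase, mem_univ, and_true] at hx
    simp [hx.1, hx.2]
  rw [hrest]
  obtain ⟨k, hk⟩ := Nat.exists_eq_add_of_le hu
  simp [huv, hk]
  ring

/-- The weight function lemma: an unsolvable configuration weighs at most as much as the
configuration with one pebble on each vertex. -/
theorem IsWeightFunction.sum_mul_le [Fintype V] {w : V → ℕ} (hw : IsWeightFunction G r w)
    (C : V → ℕ) (hC : ¬ PebblingSolvable G r C) : ∑ v, w v * C v ≤ ∑ v, w v := by
  classical
  induction hn : ∑ v, C v using Nat.strong_induction_on generalizing C with
  | _ n ih =>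
    subst hn
    by_cases hlight : ∀ v, w v ≠ 0 → C v ≤ 1
    · refine sum_le_sum fun v _ => ?_
      by_cases hv : w v = 0
      · simp [hv]
      · simpa using Nat.mul_le_mul_left (w v) (hlight v hv)
    · push Not at hlight
      obtain ⟨v, hv, hCv⟩ := hlight
      rcases hw.2 v hv with hr | ⟨p, hp, hwp⟩
      · exact absurd ⟨_, .single (pebblingMove_update hr hCv), by simp⟩ hC
      · have hsize := sum_mul_update_update (fun _ => 1) C hp.ne hCv
        have hweight := sum_mul_update_update w C hp.ne hCv
        simp only [one_mul] at hsize
        have := ih _ (by omega) _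
          (fun h => hC (.of_pebblingMove (pebblingMove_update hp hCv) h)) rfl
        omega

/-- If a family of weight functions for `r` has total weight at least `M` at every vertex other
than `r`, and its total weight is less than `M * t`, then every configuration of size `t` is
`r`-solvable. -/
theorem pebblingSolvable_of_weightFunctions [Fintype V] {W : List (V → ℕ)} {M t : ℕ}
    (hW : ∀ w ∈ W, IsWeightFunction G r w) (hM : ∀ v, v ≠ r → M ≤ (W.map (· v)).sum)
    (ht : (W.map fun w => ∑ v, w v).sum < M * t) {C : V → ℕ} (hC : ∑ v, C v = t) :
    PebblingSolvable G r C := by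
  by_contra hns
  have hr : C r = 0 := by
    by_contra h
    exact hns ⟨C, .refl, Nat.one_le_iff_ne_zero.2 h⟩
  have hcover : M * t ≤ ∑ v, (W.map (· v)).sum * C v := by
    rw [← hC, mul_sum]
    refine sum_le_sum fun v _ => ?_
    by_cases hv : v = r
    · simp [hv, hr]
    · exact Nat.mul_le_mul_right _ (hM v hv)
  have hswap (L : List (V → ℕ)) :
      ∑ v, (L.map (· v)).sum * C v = (L.map fun w => ∑ v, w v * C v).sum := by
    induction L with
    | nil => simp
    | cons w L ih => simp [add_mul, sum_add_distrib, ih]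
  have hle := List.sum_le_sum fun w hw => (hW w hw).sum_mul_le C hns
  rw [hswap] at hcover
  omega

/-- The configuration with one pebble on each vertex of `s`, where `r ∉ s`, is not
`r`-solvable. -/
theorem not_pebblingSolvable_indicator [DecidableEq V] {s : Finset V} (hr : r ∉ s) :
    ¬ PebblingSolvable G r fun v => if v ∈ s then 1 else 0 := by
  rintro ⟨D, hD, hDr⟩
  rcases hD.cases_head with rfl | ⟨C', ⟨u, v, -, hu, -⟩, -⟩
  · simp [hr] at hDr
  · dsimp only at hu
    split_ifs at hu <;> omega

/-- The lower bound `|V(G)| ≤ π(G, r)`, provided that some size is always solvable. -/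
theorem card_le_piVertex [Fintype V] {t : ℕ}
    (h : ∀ C : V → ℕ, ∑ v, C v = t → PebblingSolvable G r C) :
    Fintype.card V ≤ piVertex G r := by
  classical
  refine le_csInf ⟨t, h⟩ fun k hk => ?_
  by_contra! hlt
  obtain ⟨s, hs, hcard⟩ := exists_subset_card_eq
    (s := univ.erase r) (n := k) (by rw [card_erase_of_mem (mem_univ r), card_univ]; omega)
  exact not_pebblingSolvable_indicator (G := G) (r := r) (s := s)
    (fun hr => by simpa using hs hr) (hk _ (by simpa using hcard))

end WeightFunctions

instance : DecidableRel R20.Adj := fun i j =>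
  decidable_of_iff (i ≠ j ∧ ((i, j) ∈ r20Edges ∨ (j, i) ∈ r20Edges))
    (fromRel_adj (fun i j => (i, j) ∈ r20Edges) i j).symm

/-- The function taking the listed values at the listed vertices, and zero elsewhere. -/
def weightOfList (l : List (Fin 20 × ℕ)) (v : Fin 20) : ℕ :=
  (l.lookup v).getD 0

/-- For each root of `R_20`, a family of weight functions, each given by its nonzero values. -/
def r20Weights : Fin 20 → List (List (Fin 20 × ℕ)) :=
  ![
   [[(5, 60), (1, 30), (2, 30), (3, 30)],
    [(11, 40), (2, 20), (4, 20), (6, 20)],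
    [(13, 96), (2, 48), (4, 48), (8, 48)],
    [(7, 40), (1, 20), (6, 20), (9, 20), (16, 10)],
    [(10, 40), (6, 20), (8, 20), (12, 20), (1, 10), (3, 10)],
    [(16, 32), (1, 16), (6, 16), (18, 16), (3, 8), (4, 8), (12, 8), (17, 8)],
    [(14, 40), (1, 20), (3, 20), (4, 20), (6, 20), (18, 20), (12, 10), (17, 10)],
    [(10, 68), (12, 34), (17, 34), (19, 34), (9, 17), (18, 17)],
    [(15, 96), (9, 48), (17, 48), (19, 48), (12, 24), (18, 24), (6, 12), (4, 6), (10, 6)],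
    [(5, 56), (7, 56), (11, 56), (14, 56), (16, 56), (3, 28), (8, 28), (9, 28), (18, 28),
     (19, 14)]],
   [[(3, 16), (4, 16), (5, 16), (6, 16), (7, 16), (9, 16), (14, 16), (15, 16), (16, 16),
     (17, 16), (18, 16), (19, 16), (0, 8), (2, 8), (8, 8), (10, 8), (11, 8), (12, 8), (13, 8)],
    [(14, 8), (0, 4)],
    [(5, 18), (0, 9), (2, 9)],
    [(18, 24), (8, 12), (12, 12), (10, 6), (11, 6), (0, 3), (2, 3)],
    [(6, 16), (10, 8), (11, 8), (12, 8), (0, 4), (2, 4), (8, 4)],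
    [(17, 16), (10, 8), (13, 8), (0, 4), (2, 4), (8, 4), (11, 2)],
    [(4, 16), (11, 8), (13, 8), (0, 4), (2, 4), (8, 4), (10, 4)],
    [(3, 16), (7, 16), (9, 16), (15, 16), (16, 16), (19, 16), (11, 8), (12, 8), (13, 8),
     (14, 8)]],
   [[(5, 48), (0, 24), (1, 24)],
    [(11, 8), (0, 4), (4, 4), (12, 4), (8, 2)],
    [(13, 48), (0, 24), (4, 24), (8, 24), (1, 12)],
    [(11, 40), (0, 20), (4, 20), (6, 20), (15, 20), (10, 10)],
    [(7, 128), (0, 64), (1, 64), (6, 64), (9, 64), (10, 64), (14, 64), (16, 64), (8, 32),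
     (15, 32)],
    [(3, 40), (1, 20), (8, 20), (17, 20), (9, 10), (10, 10), (0, 5)],
    [(19, 96), (8, 48), (9, 48), (12, 48), (18, 48), (16, 24)],
    [(19, 64), (4, 32), (12, 32), (15, 32), (17, 32), (18, 32), (14, 16), (16, 16)],
    [(3, 80), (4, 40), (14, 40), (17, 40), (18, 40)],
    [(5, 72), (11, 72), (13, 72), (6, 36), (10, 36), (12, 36), (15, 36), (17, 36), (9, 18),
     (16, 18)]],
   [[(1, 36), (2, 36), (4, 36), (5, 36), (7, 36), (8, 36), (11, 36), (14, 36), (17, 36),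
     (18, 36), (0, 18), (6, 18), (9, 18), (10, 18), (12, 18), (13, 18), (15, 18), (16, 18),
     (19, 18)],
    [(11, 38), (0, 19)],
    [(11, 12), (0, 6), (12, 6), (7, 3)],
    [(8, 12), (9, 6), (10, 6), (13, 6), (0, 3)],
    [(1, 48), (6, 24), (9, 24), (15, 24), (16, 24), (5, 12), (7, 12), (10, 12), (12, 12),
     (13, 12), (0, 6), (8, 6), (19, 3)],
    [(17, 48), (18, 48), (6, 24), (9, 24), (10, 24), (12, 24), (13, 24), (15, 24), (16, 24),
     (0, 12)],
    [(4, 48), (6, 24), (15, 24), (19, 24), (0, 12), (9, 12), (10, 12), (12, 12)],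
    [(8, 32), (9, 16), (10, 16), (19, 16), (0, 8), (15, 4), (1, 2), (11, 2)],
    [(2, 48), (5, 48), (7, 48), (14, 48), (13, 24), (16, 24), (19, 24), (12, 12)]],
   [[(1, 8), (3, 8), (6, 8), (11, 8), (13, 8), (14, 8), (15, 8), (17, 8), (19, 8), (0, 4),
     (2, 4), (5, 4), (7, 4), (8, 4), (9, 4), (10, 4), (12, 4), (16, 4), (18, 4)],
    [(15, 8), (0, 4), (9, 4), (10, 4), (5, 2), (7, 2), (8, 2)],
    [(13, 8), (0, 4), (2, 4), (7, 4), (10, 4), (5, 2)],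
    [(19, 8), (2, 4), (8, 4), (9, 4), (12, 4), (5, 2), (7, 2), (0, 1)],
    [(6, 8), (14, 4), (16, 4)],
    [(3, 8), (2, 4), (5, 4), (8, 4), (18, 4), (0, 2), (9, 2), (10, 2), (12, 2), (16, 2)],
    [(1, 8), (5, 4), (9, 4), (16, 4), (18, 4), (0, 2), (2, 2), (12, 2), (10, 1)],
    [(11, 8), (14, 8), (17, 8), (7, 4), (10, 4), (12, 4), (18, 4), (8, 2), (16, 2)]],
   [[(0, 20), (1, 20), (2, 20), (3, 20), (6, 20), (7, 20), (13, 20), (14, 20), (18, 20),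
     (4, 10), (8, 10), (9, 10), (10, 10), (11, 10), (12, 10), (15, 10), (16, 10), (17, 10),
     (19, 10)],
    [(14, 16), (4, 8)],
    [(7, 8), (14, 8), (4, 4), (9, 4)],
    [(18, 16), (9, 8), (12, 8), (19, 8), (4, 4), (11, 4)],
    [(13, 24), (4, 12), (8, 12), (10, 12), (17, 12), (11, 6), (12, 6), (15, 6)],
    [(6, 24), (4, 12), (10, 12), (11, 12), (12, 12), (17, 12), (8, 6), (15, 6)],
    [(0, 8), (3, 8), (4, 4), (8, 4), (10, 4), (11, 4), (15, 4), (17, 4), (12, 2)],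
    [(18, 8), (8, 4), (9, 4), (16, 4), (19, 4), (4, 2), (15, 2)],
    [(1, 28), (9, 14), (15, 14), (16, 14), (19, 14), (4, 7)],
    [(0, 16), (2, 16), (3, 16), (8, 8), (16, 8), (17, 8), (9, 4), (12, 4)],
    [(2, 16), (7, 16), (10, 8), (11, 8), (16, 8), (19, 8), (12, 4), (15, 4)]],
   [[(1, 16), (4, 16), (5, 16), (7, 16), (10, 16), (11, 16), (12, 16), (13, 16), (14, 16),
     (16, 16), (17, 16), (0, 8), (2, 8), (3, 8), (8, 8), (9, 8), (15, 8), (18, 8), (19, 8)],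
    [(13, 8), (0, 4), (2, 4)],
    [(7, 8), (10, 8), (2, 4), (3, 4), (8, 4), (9, 4)],
    [(11, 8), (3, 4), (15, 4), (0, 2), (2, 2), (8, 2)],
    [(16, 8), (0, 4), (18, 4), (9, 2), (15, 2)],
    [(14, 8), (0, 4), (18, 4), (9, 2), (15, 2)],
    [(5, 8), (0, 4), (2, 4), (18, 4), (9, 2), (15, 2)],
    [(12, 16), (8, 8), (19, 8), (3, 4), (9, 4), (15, 4), (0, 2)],
    [(17, 8), (3, 4), (9, 4), (19, 4), (2, 2), (15, 2), (0, 1)],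
    [(1, 8), (4, 8), (9, 4), (18, 4), (19, 4), (8, 2)]],
   [[(0, 16), (1, 16), (2, 16), (3, 16), (5, 16), (6, 16), (9, 16), (10, 16), (13, 16),
     (14, 16), (16, 16), (4, 8), (8, 8), (11, 8), (12, 8), (15, 8), (17, 8), (18, 8), (19, 8)],
    [(10, 8), (8, 4), (15, 4), (4, 2), (11, 2)],
    [(3, 12), (4, 6), (8, 6), (11, 6), (17, 6), (18, 6), (12, 3), (15, 3)],
    [(9, 8), (8, 4), (15, 4), (18, 4), (19, 4), (4, 2), (11, 2), (12, 2)],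
    [(2, 8), (11, 4), (19, 4), (4, 2), (8, 2), (12, 2), (15, 2), (18, 2)],
    [(1, 8), (4, 4), (15, 4), (18, 4), (19, 4), (8, 2), (11, 2), (12, 2)],
    [(0, 8), (5, 8), (6, 8), (14, 8), (12, 4), (17, 4), (19, 2)],
    [(13, 12), (16, 12), (6, 6), (17, 6), (12, 3), (19, 3)]],
   [[(10, 96), (0, 48)],
    [(18, 28), (5, 14), (0, 7)],
    [(19, 16), (1, 8), (2, 8), (4, 8), (5, 4), (11, 4), (0, 2)],
    [(3, 48), (1, 24), (2, 24), (5, 24), (11, 24), (0, 12), (9, 12), (14, 6), (18, 3)],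
    [(9, 48), (1, 24), (15, 24), (0, 12), (5, 12), (14, 12), (2, 6)],
    [(19, 80), (1, 40), (2, 40), (15, 40), (0, 20), (5, 20), (14, 20)],
    [(9, 36), (7, 18), (15, 18), (17, 18), (4, 9), (6, 9), (11, 9)],
    [(13, 108), (4, 54), (6, 54), (7, 54), (17, 54), (11, 27), (15, 27)],
    [(12, 66), (16, 66), (18, 66), (6, 33), (7, 33), (11, 33), (14, 33)],
    [(3, 50), (12, 50), (16, 50), (2, 25), (4, 25), (5, 25), (14, 25), (17, 25)]],
   [[(7, 4), (0, 2), (2, 2)],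
    [(19, 4), (4, 2), (10, 2), (12, 2), (0, 1), (3, 1), (11, 1)],
    [(15, 8), (0, 4), (4, 4), (10, 4), (11, 4), (3, 2), (12, 2)],
    [(1, 8), (3, 4), (4, 4), (5, 4), (14, 4), (0, 2), (11, 2), (13, 2)],
    [(8, 8), (3, 4), (10, 4), (13, 4), (16, 4), (2, 2), (5, 2), (6, 2), (11, 2)],
    [(7, 8), (2, 4), (3, 4), (5, 4), (6, 4), (10, 4), (13, 4), (16, 4), (11, 2)],
    [(17, 8), (18, 8), (6, 4), (12, 4), (14, 4), (16, 4), (0, 2)],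
    [(1, 4), (17, 4), (19, 4), (2, 2), (6, 2), (12, 2), (14, 2), (16, 2), (0, 1)],
    [(8, 4), (15, 4), (18, 4), (19, 4), (2, 2), (4, 2), (5, 2), (11, 2), (12, 2), (13, 2),
     (14, 2), (6, 1)]],
   [[(0, 24), (6, 24), (7, 24), (8, 24), (12, 24), (13, 24), (15, 24), (17, 24), (19, 24),
     (1, 12), (2, 12), (3, 12), (4, 12), (5, 12), (9, 12), (11, 12), (14, 12), (16, 12),
     (18, 12)],
    [(17, 12), (1, 6), (3, 6), (2, 3)],
    [(17, 24), (1, 12), (9, 12)],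
    [(19, 24), (1, 12), (2, 12), (4, 12), (9, 12)],
    [(6, 24), (1, 12), (4, 12), (5, 12), (14, 12), (2, 6), (3, 6)],
    [(0, 32), (5, 16), (14, 16), (1, 8), (2, 8), (3, 8), (4, 8)],
    [(12, 32), (11, 16), (18, 16), (1, 8), (2, 8), (3, 8), (4, 8), (5, 8), (16, 8)],
    [(8, 32), (3, 16), (16, 16), (18, 16), (1, 8), (2, 8), (4, 8), (5, 8), (11, 8)],
    [(7, 32), (13, 32), (15, 32), (9, 16), (11, 16), (14, 16), (16, 16), (18, 8)],
    [(6, 8), (13, 8), (15, 8), (19, 8), (9, 4), (11, 4), (14, 4), (16, 4), (18, 4)]],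
   [[(0, 12), (2, 12), (3, 12), (4, 12), (6, 12), (12, 12), (15, 12), (1, 6), (5, 6), (7, 6),
     (8, 6), (9, 6), (10, 6), (13, 6), (14, 6), (16, 6), (17, 6), (18, 6), (19, 6)],
    [(6, 16), (15, 16), (5, 8), (9, 8), (13, 8), (8, 4)],
    [(0, 44), (15, 44), (5, 22), (9, 22), (13, 22), (8, 11)],
    [(0, 52), (7, 26), (10, 26), (13, 26), (16, 26), (1, 13), (8, 13)],
    [(6, 80), (5, 40), (7, 40), (13, 40), (14, 40), (16, 40), (17, 40), (8, 20), (9, 20)],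
    [(12, 96), (8, 48), (10, 48), (18, 48), (5, 24), (7, 24), (9, 24), (13, 24), (16, 24)],
    [(4, 40), (13, 20), (17, 20), (19, 20), (5, 10), (7, 10), (8, 10), (9, 10), (10, 10)],
    [(15, 36), (1, 18), (9, 18), (10, 18), (17, 18), (19, 18), (5, 9), (7, 9), (8, 9), (13, 9)],
    [(4, 48), (1, 24), (14, 24), (19, 24), (16, 12), (18, 12)],
    [(2, 96), (3, 96), (1, 48), (14, 48), (18, 48), (19, 48), (17, 24), (4, 12)]],
   [[(11, 40), (0, 20), (2, 20), (3, 20), (1, 10), (7, 5)],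
    [(6, 24), (4, 12), (5, 12), (7, 12), (2, 6), (3, 6), (9, 6)],
    [(11, 8), (18, 8), (2, 4), (3, 4), (4, 4), (5, 4), (9, 4), (7, 2)],
    [(8, 24), (3, 12), (13, 12), (4, 6), (17, 6)],
    [(6, 4), (11, 4), (3, 2), (4, 2), (13, 2), (16, 2), (17, 2)],
    [(18, 44), (1, 22), (5, 22), (14, 22), (16, 22), (2, 11), (13, 11), (17, 11)],
    [(6, 28), (1, 14), (5, 14), (13, 14), (14, 14), (16, 14), (17, 14), (2, 7)],
    [(19, 56), (4, 28), (9, 28), (15, 28), (0, 14), (13, 14), (14, 14)],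
    [(10, 52), (0, 26), (7, 26), (15, 26), (17, 26)],
    [(8, 28), (3, 14), (9, 14), (16, 14), (1, 7), (2, 7), (7, 7), (14, 7), (15, 7)]],
   [[(6, 16), (1, 8), (9, 4), (15, 4), (17, 4), (11, 2), (3, 1), (12, 1)],
    [(2, 8), (7, 8), (3, 4), (11, 4), (14, 4)],
    [(6, 8), (1, 4), (11, 4), (12, 4), (14, 4), (16, 4), (9, 2), (15, 2)],
    [(4, 8), (8, 8), (1, 4), (9, 4), (11, 4), (12, 4), (14, 4), (15, 4), (16, 4)],
    [(8, 8), (3, 4), (12, 4), (18, 4), (1, 2), (11, 2), (15, 1)],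
    [(5, 12), (1, 6), (3, 6), (18, 6), (11, 3), (12, 3), (15, 3)],
    [(17, 20), (3, 10), (9, 10), (15, 10), (19, 10)],
    [(2, 8), (8, 8), (10, 4), (16, 4), (18, 4), (19, 4)],
    [(0, 8), (2, 8), (10, 8), (14, 4), (16, 4), (19, 4), (18, 2)],
    [(0, 16), (4, 16), (5, 16), (7, 16), (10, 16), (9, 8), (11, 8), (12, 8), (14, 8), (16, 8),
     (18, 8), (19, 8)]],
   [[(5, 4), (2, 2)],
    [(7, 4), (2, 2), (9, 2), (8, 1)],
    [(3, 8), (2, 4), (8, 4), (11, 4)],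
    [(6, 4), (11, 2), (12, 2), (13, 2), (15, 1)],
    [(0, 4), (11, 2), (13, 2), (15, 2), (12, 1)],
    [(0, 8), (10, 4), (11, 4), (15, 4), (16, 4), (2, 2), (9, 2), (12, 2)],
    [(6, 8), (10, 4), (13, 4), (16, 4), (17, 4)],
    [(4, 12), (18, 12), (8, 6), (9, 6), (12, 6), (15, 6), (17, 6), (19, 6), (2, 3), (10, 3)],
    [(1, 4), (9, 2), (15, 2), (17, 2), (19, 2), (2, 1), (8, 1), (10, 1), (12, 1)],
    [(1, 8), (5, 8), (7, 8), (3, 4), (13, 4), (16, 4), (19, 4), (11, 2)]],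
   [[(0, 18), (1, 18), (4, 18), (9, 18), (10, 18), (11, 18), (17, 18), (19, 18), (2, 9), (3, 9),
     (5, 9), (6, 9), (7, 9), (8, 9), (12, 9), (13, 9), (14, 9), (16, 9), (18, 9)],
    [(11, 136), (2, 68)],
    [(10, 136), (7, 68), (12, 68), (3, 34), (6, 34), (8, 34), (2, 17)],
    [(4, 24), (3, 12), (13, 12), (14, 12), (8, 6)],
    [(17, 136), (3, 68), (13, 68), (2, 34), (8, 34), (14, 34), (12, 17)],
    [(0, 24), (13, 12), (14, 12), (2, 6), (3, 6), (8, 6), (12, 3)],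
    [(9, 24), (7, 12), (8, 12), (18, 12), (5, 6), (14, 6), (16, 6), (6, 3)],
    [(19, 32), (8, 16), (18, 16), (5, 8), (14, 8), (16, 8), (3, 4), (7, 2)],
    [(1, 44), (5, 22), (7, 22), (14, 22), (16, 22), (18, 22), (3, 11), (8, 11)],
    [(1, 104), (3, 52), (5, 52), (6, 52), (7, 52), (14, 52), (16, 52), (18, 52), (8, 26)],
    [(0, 112), (4, 112), (9, 112), (19, 112), (2, 56), (5, 56), (6, 56), (12, 56), (13, 56),
     (16, 56), (18, 56)]],
   [[(7, 40), (2, 20), (13, 20), (4, 10)],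
    [(6, 48), (4, 24), (5, 24), (10, 24), (11, 24), (13, 24), (2, 12), (3, 12), (19, 12)],
    [(8, 20), (3, 10), (10, 10), (13, 10), (19, 10), (2, 5), (4, 5), (5, 5), (11, 5)],
    [(18, 32), (3, 16), (12, 16), (4, 8), (11, 8), (13, 4)],
    [(18, 24), (3, 12), (14, 12), (19, 12), (2, 6), (4, 6), (11, 6), (13, 3)],
    [(18, 40), (5, 20), (9, 20), (12, 20), (14, 20), (4, 10), (10, 10), (13, 10), (15, 10)],
    [(1, 96), (3, 48), (4, 48), (5, 48), (9, 48), (15, 48), (17, 48), (10, 24), (11, 24),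
     (13, 24), (12, 12)],
    [(0, 96), (8, 96), (12, 48), (14, 48), (15, 48), (19, 48), (2, 24), (17, 24)],
    [(6, 56), (7, 56), (2, 28), (9, 28), (10, 28), (11, 28), (14, 28), (17, 28), (19, 14)]],
   [[(13, 40), (0, 20)],
    [(3, 24), (2, 12), (5, 12), (7, 12), (0, 6)],
    [(3, 16), (4, 8), (5, 8), (8, 8), (11, 8), (14, 8)],
    [(19, 40), (2, 20), (8, 20), (12, 20), (18, 20), (5, 10), (11, 10), (14, 10), (0, 5)],
    [(6, 40), (7, 20), (11, 20), (14, 20), (16, 20), (0, 10)],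
    [(1, 16), (7, 8), (14, 8), (16, 8), (0, 4), (11, 2)],
    [(4, 16), (9, 16), (10, 16), (15, 16), (8, 8), (12, 8), (18, 8), (5, 4), (16, 4), (2, 2)],
    [(1, 24), (4, 24), (9, 24), (10, 24), (15, 24), (5, 12), (8, 12), (12, 12), (16, 12),
     (18, 12), (2, 6)]],
   [[(16, 8), (0, 4), (6, 4)],
    [(8, 8), (10, 4), (13, 4), (0, 2), (6, 2), (11, 1)],
    [(5, 44), (0, 22), (6, 22), (13, 22), (10, 11), (11, 11)],
    [(19, 16), (2, 8), (4, 8), (10, 8), (15, 8), (0, 4), (7, 4), (11, 4)],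
    [(1, 32), (4, 16), (7, 16), (15, 16), (0, 8), (2, 8), (10, 8), (11, 8)],
    [(19, 16), (2, 8), (10, 8), (17, 8), (0, 4), (7, 4), (13, 4)],
    [(3, 32), (2, 16), (7, 16), (17, 16), (0, 8), (10, 8), (13, 8)],
    [(8, 32), (9, 32), (12, 32), (14, 32), (16, 32), (4, 16), (6, 16), (11, 16), (15, 16),
     (17, 16)],
    [(1, 8), (3, 8), (9, 8), (12, 8), (14, 8), (19, 8), (6, 4), (15, 4), (13, 2)]],
   [[(1, 12), (2, 12), (4, 12), (8, 12), (9, 12), (10, 12), (12, 12), (15, 12), (17, 12),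
     (18, 12), (0, 6), (3, 6), (5, 6), (6, 6), (7, 6), (11, 6), (13, 6), (14, 6), (16, 6)],
    [(8, 24), (15, 24), (0, 12), (3, 12)],
    [(10, 8), (0, 4), (6, 4), (5, 2), (3, 1)],
    [(10, 16), (0, 8), (7, 8), (3, 4), (5, 4)],
    [(17, 28), (3, 14), (6, 14), (13, 14), (0, 7)],
    [(2, 24), (9, 24), (18, 24), (5, 12), (7, 12), (11, 12), (13, 12), (14, 12), (16, 12)],
    [(1, 24), (4, 24), (5, 12), (11, 12), (13, 12), (14, 12), (16, 12), (7, 6)],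
    [(12, 24), (6, 12), (11, 12), (0, 6), (7, 6), (13, 6), (14, 6), (16, 6)]]]

/-- For each root of `R_20`, a lower bound for the total weight of `r20Weights` at every other
vertex. -/
def r20Cover : Fin 20 → ℕ :=
  ![96, 32, 120, 84, 16, 44, 24, 24, 96, 12, 56, 108, 52, 24, 12, 153, 95, 40, 40, 36]

theorem isWeightFunction_r20Weights (r : Fin 20) :
    ∀ l ∈ r20Weights r, IsWeightFunction R20 r (weightOfList l) := by
  unfold IsWeightFunction
  revert r
  decide +kernel

theorem r20Cover_le (r : Fin 20) :
    ∀ v, v ≠ r → r20Cover r ≤ (((r20Weights r).map weightOfList).map (· v)).sum := by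
  revert r
  decide +kernel

theorem sum_r20Weights_lt (r : Fin 20) :
    (((r20Weights r).map weightOfList).map fun w => ∑ v, w v).sum < r20Cover r * 20 := by
  revert r
  decide +kernel

theorem pebblingSolvable_r20 (r : Fin 20) (C : Fin 20 → ℕ) (hC : ∑ v, C v = 20) :
    PebblingSolvable R20 r C :=
  pebblingSolvable_of_weightFunctions
    (by simpa using isWeightFunction_r20Weights r) (r20Cover_le r) (sum_r20Weights_lt r) hC

/-- `R_20` is Class 0: `π(R_20) = 20`. -/
theorem r20_class0 : pebblingNumber R20 = 20 := by
  refine le_antisymm (Finset.sup_le fun r _ => Nat.sInf_le (pebblingSolvable_r20 r)) ?_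
  calc 20 = Fintype.card (Fin 20) := (Fintype.card_fin 20).symm
    _ ≤ piVertex R20 0 := card_le_piVertex (pebblingSolvable_r20 0)
    _ ≤ pebblingNumber R20 := Finset.le_sup (f := fun r => piVertex R20 r) (mem_univ 0)
end

section
/- For every k ≥ 2, the even cycle C_{2k} on 2k vertices has pebbling number π(C_{2k}) = 2^k. -/
open Finset SimpleGraph

variable {V : Type*}

theorem PebblingSolvable.of_reflTransGen {G : SimpleGraph V} {r : V} {C C' : V → ℕ}
    (h : Relation.ReflTransGen (PebblingMove G) C C') (hC' : PebblingSolvable G r C') :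
    PebblingSolvable G r C := by
  obtain ⟨D, hD, hr⟩ := hC'
  exact ⟨D, h.trans hD, hr⟩

/-- Along an edge `uv`, `j` consecutive moves are possible as soon as `u` holds `2 * j` pebbles. -/
theorem exists_reflTransGen_pebblingMove {G : SimpleGraph V} {u v : V} (huv : G.Adj u v)
    (C : V → ℕ) (j : ℕ) (hj : 2 * j ≤ C u) :
    ∃ C', Relation.ReflTransGen (PebblingMove G) C C' ∧ C' u = C u - 2 * j ∧
      C' v = C v + j ∧ ∀ x, x ≠ u → x ≠ v → C' x = C x := by
  classical
  induction j with
  | zero => exact ⟨C, .refl, by simp, by simp, fun _ _ _ => rfl⟩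
  | succ j ih =>
    obtain ⟨D, hD, hu, hv, hx⟩ := ih (by omega)
    have hne : v ≠ u := huv.ne'
    let E := Function.update (Function.update D u (D u - 2)) v (D v + 1)
    have hEu : E u = D u - 2 := by simp [E, hne.symm]
    have hEv : E v = D v + 1 := by simp [E]
    have hEx : ∀ x, x ≠ u → x ≠ v → E x = D x := fun x h1 h2 => by simp [E, h1, h2]
    refine ⟨E, hD.tail ⟨u, v, huv, by omega, hEu, hEv, hEx⟩, by omega, by omega, ?_⟩
    intro x h1 h2
    rw [hEx x h1 h2, hx x h1 h2]

/-- A configuration whose weight along a path of length `m` starting at the root is at least `2 ^ m`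
is solvable. -/
theorem pebblingSolvable_of_path {G : SimpleGraph V} (p : ℕ → V) (m : ℕ)
    (hadj : ∀ i < m, G.Adj (p (i + 1)) (p i)) (hinj : Set.InjOn p (Set.Iic m)) (C : V → ℕ)
    (hC : 2 ^ m ≤ ∑ i ∈ range (m + 1), 2 ^ (m - i) * C (p i)) :
    PebblingSolvable G (p 0) C := by
  induction m generalizing C with
  | zero => exact ⟨C, .refl, by simpa using hC⟩
  | succ m ih =>
    obtain ⟨C', hCC', -, hv, hx⟩ := exists_reflTransGen_pebblingMove (hadj m (by omega)) C
      (C (p (m + 1)) / 2) (by omega)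
    refine .of_reflTransGen hCC' (ih (fun i hi => hadj i (by omega))
      (hinj.mono (Set.Iic_subset_Iic.2 (by omega))) C' ?_)
    have hrest : ∑ i ∈ range m, 2 ^ (m + 1 - i) * C (p i) =
        2 * ∑ i ∈ range m, 2 ^ (m - i) * C' (p i) := by
      rw [mul_sum]
      refine sum_congr rfl fun i hi => ?_
      have hi := mem_range.1 hi
      have h1 : p i ≠ p (m + 1) := fun h => by
        have := hinj (by simp; omega) (by simp) h
        omega
      have h2 : p i ≠ p m := fun h => by
        have := hinj (by simp; omega) (by simp) h
        omega
      rw [hx _ h1 h2, Nat.succ_sub hi.le, pow_succ]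
      ring
    rw [sum_range_succ, sum_range_succ, hrest, pow_succ] at hC
    rw [sum_range_succ, hv]
    simp only [Nat.add_sub_cancel_left, Nat.sub_self, pow_zero, pow_one, one_mul] at hC ⊢
    omega

/-- A weight that at most doubles along each edge gives a quantity that no pebbling move increases. -/
theorem PebblingMove.sum_mul_le [Fintype V] {G : SimpleGraph V} {w : V → ℕ}
    (hw : ∀ u v, G.Adj u v → w v ≤ 2 * w u) {C C' : V → ℕ} (h : PebblingMove G C C') :
    ∑ x, w x * C' x ≤ ∑ x, w x * C x := by
  classical
  obtain ⟨u, v, huv, h2, hu, hv, hx⟩ := h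
  have hvu : v ∈ univ.erase u := by simp [huv.ne']
  rw [← add_sum_erase _ _ (mem_univ u), ← add_sum_erase _ _ hvu,
    ← add_sum_erase _ (fun x => w x * C x) (mem_univ u), ← add_sum_erase _ _ hvu]
  have hrest : ∑ x ∈ (univ.erase u).erase v, w x * C' x =
      ∑ x ∈ (univ.erase u).erase v, w x * C x := by
    refine sum_congr rfl fun x h => ?_
    simp only [mem_erase, mem_univ, and_true] at h
    rw [hx x h.2 h.1]
  obtain ⟨c, hc⟩ := Nat.exists_eq_add_of_le h2
  rw [hrest, hu, hv, hc, Nat.add_sub_cancel_left]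
  nlinarith [hw u v huv]

theorem PebblingSolvable.le_sum_mul [Fintype V] {G : SimpleGraph V} {w : V → ℕ} {r : V}
    (hw : ∀ u v, G.Adj u v → w v ≤ 2 * w u) {C : V → ℕ} (h : PebblingSolvable G r C) :
    w r ≤ ∑ x, w x * C x := by
  obtain ⟨C', hCC', hr⟩ := h
  have hle : ∑ x, w x * C' x ≤ ∑ x, w x * C x := by
    clear hr
    induction hCC' with
    | refl => exact le_rfl
    | tail _ hmove ih => exact (hmove.sum_mul_le hw).trans ih
  calc w r ≤ w r * C' r := Nat.le_mul_of_pos_right _ hr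
    _ ≤ ∑ x, w x * C' x := single_le_sum (f := fun x => w x * C' x) (fun _ _ => Nat.zero_le _)
      (mem_univ r)
    _ ≤ _ := hle

theorem cycleGraph_adj_ofNat_succ {n : ℕ} [NeZero n] (hn : 2 ≤ n) (a : ℕ) :
    (cycleGraph n).Adj (Fin.ofNat n (a + 1)) (Fin.ofNat n a) := by
  rw [cycleGraph_adj']
  left
  obtain ⟨m, rfl⟩ := Nat.exists_eq_add_of_le' hn
  have h : Fin.ofNat (m + 2) (a + 1) = Fin.ofNat (m + 2) a + 1 := by
    ext
    simp [Fin.val_add]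
  rw [h, add_sub_cancel_left]
  rfl

theorem two_mul_sum_range_le {k : ℕ} (hk : 0 < k) (f : ℕ → ℕ) :
    2 * ∑ i ∈ range (2 * k), f i ≤ ∑ i ∈ range (k + 1), 2 ^ (k - i) * f i +
      ∑ i ∈ range (k + 1), 2 ^ (k - i) * f (k + (k - i)) := by
  obtain ⟨m, rfl⟩ := Nat.exists_eq_add_one_of_ne_zero hk.ne'
  have h1 : 2 * ∑ i ∈ range (m + 1), f i ≤ ∑ i ∈ range (m + 1), 2 ^ (m + 1 - i) * f i := by
    rw [mul_sum]
    refine sum_le_sum fun i hi => Nat.mul_le_mul_right _ ?_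
    have := mem_range.1 hi
    exact Nat.le_self_pow (by omega) 2
  have h2 : 2 * ∑ j ∈ range m, f (m + 1 + (j + 1)) ≤
      ∑ j ∈ range (m + 1), 2 ^ (j + 1) * f (m + 1 + (j + 1)) := by
    rw [mul_sum]
    refine (sum_le_sum fun j _ => Nat.mul_le_mul_right _ ?_).trans
      (sum_le_sum_of_subset (range_mono (Nat.le_succ m)))
    exact Nat.le_self_pow (by omega) 2
  have h3 := sum_range_reflect (fun j => 2 ^ j * f (m + 1 + j)) (m + 1 + 1)
  simp only [Nat.add_sub_cancel] at h3
  rw [h3, sum_range_succ' (fun j => 2 ^ j * f (m + 1 + j)),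
    sum_range_succ (fun i => 2 ^ (m + 1 - i) * f i), two_mul (m + 1), sum_range_add,
    sum_range_succ' (fun j => f (m + 1 + j)) m]
  simp only [Nat.sub_self, pow_zero, one_mul, add_zero]
  omega

theorem pebblingSolvable_cycleGraph {k : ℕ} (hk : 0 < k) (r : Fin (2 * k)) (C : Fin (2 * k) → ℕ)
    (hC : 2 ^ k ≤ ∑ v, C v) : PebblingSolvable (cycleGraph (2 * k)) r C := by
  have : NeZero (2 * k) := ⟨by omega⟩
  have hsum : ∑ v, C v = ∑ i ∈ range (2 * k), C (Fin.ofNat (2 * k) (r + i)) := by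
    rw [sum_range, ← Equiv.sum_comp (Equiv.addLeft r)]
    refine sum_congr rfl fun i _ => congrArg C ?_
    ext
    simp [Fin.val_add]
  have h0 : Fin.ofNat (2 * k) (r + 0) = r := by
    ext
    simp
  have h0' : Fin.ofNat (2 * k) (r + (k + (k - 0))) = r := by
    ext
    simp [← two_mul, Nat.mod_eq_of_lt r.2]
  have hinj : ∀ a i j : ℕ, i ≤ k → j ≤ k →
      Fin.ofNat (2 * k) (a + i) = Fin.ofNat (2 * k) (a + j) → i = j := by
    intro a i j hi hj h
    have h' : a + i ≡ a + j [MOD 2 * k] := congrArg Fin.val h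
    exact h'.add_left_cancel'.eq_of_lt_of_lt (by omega) (by omega)
  have key := two_mul_sum_range_le hk fun i => C (Fin.ofNat (2 * k) (r + i))
  rw [← hsum] at key
  by_cases hcase : 2 ^ k ≤ ∑ i ∈ range (k + 1), 2 ^ (k - i) * C (Fin.ofNat (2 * k) (r + i))
  · have := pebblingSolvable_of_path (G := cycleGraph (2 * k))
      (fun i => Fin.ofNat (2 * k) (r + i)) k
      (fun i _ => cycleGraph_adj_ofNat_succ (by omega) _)
      (fun i hi j hj h => hinj r i j hi hj h) C hcase
    rwa [h0] at this
  · have := pebblingSolvable_of_path (G := cycleGraph (2 * k))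
      (fun i => Fin.ofNat (2 * k) (r + (k + (k - i)))) k
      (fun i hi => by
        have h : r.val + (k + (k - i)) = r.val + (k + (k - (i + 1))) + 1 := by omega
        simp only [h]
        exact (cycleGraph_adj_ofNat_succ (by omega) _).symm)
      (fun i hi j hj h => by
        simp only [Set.mem_Iic] at hi hj
        have := hinj (r + k) (k - i) (k - j) (by omega) (by omega)
          (by simpa only [add_assoc] using h)
        omega) C (by omega)
    rwa [h0'] at this

theorem two_pow_le_of_pebblingSolvable_cycleGraph {k t : ℕ} (hk : 0 < k)
    (h : ∀ C : Fin (2 * k) → ℕ, ∑ v, C v = t →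
      PebblingSolvable (cycleGraph (2 * k)) ⟨0, by omega⟩ C) : 2 ^ k ≤ t := by
  let d : Fin (2 * k) → ℕ := fun v => min v.val (2 * k - v.val)
  have hd : ∀ u v, (cycleGraph (2 * k)).Adj u v → d u ≤ d v + 1 := by
    intro u v huv
    rw [cycleGraph_adj'] at huv
    simp only [d]
    have hu := u.2
    have hv := v.2
    rcases lt_trichotomy u v with hlt | rfl | hlt
    · rw [Fin.coe_sub_iff_lt.2 hlt, Fin.sub_val_of_le hlt.le] at huv
      rw [Fin.lt_def] at hlt
      omega
    · omega
    · rw [Fin.coe_sub_iff_lt.2 hlt, Fin.sub_val_of_le hlt.le] at huv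
      rw [Fin.lt_def] at hlt
      omega
  have hw : ∀ u v, (cycleGraph (2 * k)).Adj u v → 2 ^ (k - d v) ≤ 2 * 2 ^ (k - d u) := by
    intro u v huv
    rw [← pow_succ']
    have := hd u v huv
    exact Nat.pow_le_pow_right (by omega) (by omega)
  have hsol := h (Pi.single ⟨k, by omega⟩ t) (by simp)
  simpa [d, Pi.single_apply, two_mul] using hsol.le_sum_mul (w := fun v => 2 ^ (k - d v)) hw

/-- The even cycle `C_{2k}` (`k ≥ 2`) has pebbling number `2^k`. -/
theorem even_cycle_pebbling_number (k : ℕ) (hk : 2 ≤ k) :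
    pebblingNumber (SimpleGraph.cycleGraph (2 * k)) = 2 ^ k := by
  have hmem (r : Fin (2 * k)) : 2 ^ k ∈ {t : ℕ | ∀ C : Fin (2 * k) → ℕ, (∑ v, C v) = t →
      PebblingSolvable (cycleGraph (2 * k)) r C} :=
    fun C hC => pebblingSolvable_cycleGraph (by omega) r C hC.ge
  refine le_antisymm (Finset.sup_le fun r _ => Nat.sInf_le (hmem r)) ?_
  refine le_trans ?_ (Finset.le_sup (mem_univ (⟨0, by omega⟩ : Fin (2 * k))))
  exact le_csInf ⟨_, hmem _⟩ fun t ht =>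
    two_pow_le_of_pebblingSolvable_cycleGraph (by omega) ht
end

section
/- For every m ≥ 4, the generalized Petersen graph P_{m,2}, which has n = 3m+1 vertices, satisfies π(P_{m,2}, u) = 3m+1, where u is the hub vertex. -/
open Finset SimpleGraph

variable {V : Type*}

/-- The generalized Petersen graph `P_{m,2}`: the hub `u` is `none`; the spoke
vertex `a_i` is `some (Sum.inl i)`; the outer cycle vertex `b_i` is
`some (Sum.inr i)` for `i < m`, and `c_i` is `some (Sum.inr (m + i))`, so the
outer vertices form a cycle of length `2m` in the order
`b_0, …, b_{m−1}, c_0, …, c_{m−1}`. -/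
def genPetersen (m : ℕ) : SimpleGraph (Option (Fin m ⊕ Fin (2 * m))) :=
  SimpleGraph.fromRel (fun x y =>
    (∃ i : Fin m, x = none ∧ y = some (Sum.inl i)) ∨
    (∃ (i : Fin m) (j : Fin (2 * m)), x = some (Sum.inl i) ∧ y = some (Sum.inr j) ∧
      ((j : ℕ) = (i : ℕ) ∨ (j : ℕ) = m + (i : ℕ))) ∨
    (∃ j j' : Fin (2 * m), x = some (Sum.inr j) ∧ y = some (Sum.inr j') ∧
      (j' : ℕ) = ((j : ℕ) + 1) % (2 * m)))

/-- If every vertex of positive weight has a neighbor which is either the root or at least twice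
as heavy, then a configuration heavier than the all-ones configuration is solvable. -/
theorem pebblingSolvable_of_sum_weight_lt [Fintype V] {G : SimpleGraph V} {r : V} {w : V → ℕ}
    (hr : w r = 0) (hw : ∀ v, 0 < w v → ∃ v', G.Adj v v' ∧ (v' = r ∨ 2 * w v ≤ w v'))
    (C : V → ℕ) (hC : ∑ v, w v < ∑ v, w v * C v) : PebblingSolvable G r C := by
  classical
  induction hn : ∑ v, C v using Nat.strong_induction_on generalizing C with
  | _ n ih =>
    obtain ⟨v, -, hv⟩ := Finset.exists_lt_of_sum_lt hC
    have hwv : 0 < w v := Nat.pos_of_ne_zero fun h ↦ by simp [h] at hv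
    have hCv : 2 ≤ C v := by
      by_contra! h
      have := Nat.mul_le_mul_left (w v) (Nat.le_of_lt_succ h)
      omega
    obtain ⟨v', hadj, hv'⟩ := hw v hwv
    have hne : v' ≠ v := hadj.ne'
    set C' : V → ℕ := Function.update (Function.update C v (C v - 2)) v' (C v' + 1) with hC'
    have hC'v : C' v = C v - 2 := by simp [hC', hne.symm]
    have hC'v' : C' v' = C v' + 1 := by simp [hC']
    have hC'x : ∀ x, x ≠ v → x ≠ v' → C' x = C x := fun x h h' ↦ by simp [hC', h, h']
    have hmove : PebblingMove G C C' := ⟨v, v', hadj, hCv, hC'v, hC'v', hC'x⟩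
    rcases hv' with rfl | hv'
    · exact ⟨C', .single hmove, by omega⟩
    have hsplit (f : V → ℕ) : ∑ x, f x = f v + (f v' + ∑ x ∈ (univ.erase v).erase v', f x) := by
      rw [Finset.add_sum_erase _ _ (by simp [hne]), Finset.add_sum_erase _ _ (mem_univ v)]
    have hrest (g : V → ℕ → ℕ) : ∑ x ∈ (univ.erase v).erase v', g x (C' x) =
        ∑ x ∈ (univ.erase v).erase v', g x (C x) :=
      Finset.sum_congr rfl fun x hx ↦ by
        simp only [mem_erase] at hx
        rw [hC'x x hx.2.1 hx.1]
    have hsize : ∑ x, C' x < n := by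
      have h₁ := hsplit C
      have h₂ := hsplit C'
      rw [hrest fun _ c ↦ c] at h₂
      omega
    have hweight : ∑ x, w x * C x ≤ ∑ x, w x * C' x := by
      rw [hsplit fun x ↦ w x * C x, hsplit fun x ↦ w x * C' x, hrest fun x c ↦ w x * c,
        hC'v, hC'v']
      obtain ⟨k, hk⟩ := Nat.exists_eq_add_of_le hCv
      rw [hk, Nat.add_sub_cancel_left]
      linarith
    obtain ⟨D, hD, hDr⟩ := ih _ hsize C' (hC.trans_le hweight) rfl
    exact ⟨D, .head hmove hD, hDr⟩

/-- No move is possible from a configuration with at most one pebble on each vertex. -/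
theorem not_pebblingSolvable_of_le_one {G : SimpleGraph V} {r : V} {C : V → ℕ}
    (hC : ∀ v, C v ≤ 1) (hr : C r = 0) : ¬ PebblingSolvable G r C := by
  rintro ⟨D, hD, hDr⟩
  rcases hD.cases_head with rfl | ⟨E, ⟨v, -, -, hv, -⟩, -⟩
  · omega
  · exact absurd (hC v) (by omega)

/-- If every configuration of size `t` is solvable, then `t` is at least the number of vertices. -/
theorem card_le_of_forall_pebblingSolvable [Fintype V] {G : SimpleGraph V} {r : V} {t : ℕ}
    (ht : ∀ C : V → ℕ, ∑ v, C v = t → PebblingSolvable G r C) : Fintype.card V ≤ t := by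
  classical
  by_contra! hlt
  have hcard : (univ.erase r).card = Fintype.card V - 1 := by
    rw [card_erase_of_mem (mem_univ r), card_univ]
  obtain ⟨S, hS, hSt⟩ := Finset.exists_subset_card_eq (s := univ.erase r) (n := t) (by omega)
  refine not_pebblingSolvable_of_le_one (G := G) (r := r) (C := fun v ↦ if v ∈ S then 1 else 0)
    (fun v ↦ by split_ifs <;> simp) (if_neg fun h ↦ by simpa using hS h)
    (ht _ (by simp [hSt]))

namespace genPetersen

variable {m : ℕ}

/-- The successor on the outer cycle. -/
def next (j : Fin (2 * m)) : Fin (2 * m) :=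
  ⟨if (j : ℕ) + 1 < 2 * m then j + 1 else 0, by have := j.isLt; split_ifs <;> omega⟩

/-- The predecessor on the outer cycle. -/
def prev (j : Fin (2 * m)) : Fin (2 * m) :=
  ⟨if (j : ℕ) = 0 then 2 * m - 1 else j - 1, by have := j.isLt; split_ifs <;> omega⟩

/-- The index of the spoke vertex adjacent to an outer vertex. -/
def spoke (j : Fin (2 * m)) : Fin m :=
  ⟨if (j : ℕ) < m then j else j - m, by have := j.isLt; split_ifs <;> omega⟩

theorem next_prev (j : Fin (2 * m)) : next (prev j) = j := by
  have := j.isLt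
  ext
  simp only [next, prev]
  split_ifs <;> omega

theorem spoke_next_ne (hm : 2 ≤ m) (j : Fin (2 * m)) : spoke (next j) ≠ spoke j := by
  have := j.isLt
  simp only [next, spoke, ne_eq, Fin.mk.injEq]
  split_ifs <;> omega

theorem spoke_prev_ne (hm : 2 ≤ m) (j : Fin (2 * m)) : spoke (prev j) ≠ spoke j := by
  have := spoke_next_ne hm (prev j)
  rw [next_prev] at this
  exact this.symm

theorem spoke_next_ne_spoke_prev (hm : 3 ≤ m) (j : Fin (2 * m)) :
    spoke (next j) ≠ spoke (prev j) := by
  have := j.isLt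
  simp only [next, prev, spoke, ne_eq, Fin.mk.injEq]
  split_ifs <;> omega

theorem adj_inl_none (i : Fin m) : (genPetersen m).Adj (some (.inl i)) none := by
  rw [genPetersen, fromRel_adj]
  exact ⟨by simp, .inr (.inl ⟨i, rfl, rfl⟩)⟩

theorem adj_inr_spoke (j : Fin (2 * m)) :
    (genPetersen m).Adj (some (.inr j)) (some (.inl (spoke j))) := by
  rw [genPetersen, fromRel_adj]
  refine ⟨by simp, .inr (.inr (.inl ⟨spoke j, j, rfl, rfl, ?_⟩))⟩
  simp only [spoke]
  split_ifs <;> omega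

theorem adj_next (hm : 2 ≤ m) (j : Fin (2 * m)) :
    (genPetersen m).Adj (some (.inr j)) (some (.inr (next j))) := by
  rw [genPetersen, fromRel_adj]
  refine ⟨fun h ↦ spoke_next_ne hm j ?_, .inl (.inr (.inr ⟨j, next j, rfl, rfl, ?_⟩))⟩
  · rw [← Sum.inr_injective (Option.some_injective _ h)]
  · have := j.isLt
    simp only [next]
    split_ifs with h
    · rw [Nat.mod_eq_of_lt h]
    · rw [show (j : ℕ) + 1 = 2 * m by omega, Nat.mod_self]

theorem adj_prev (hm : 2 ≤ m) (j : Fin (2 * m)) :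
    (genPetersen m).Adj (some (.inr j)) (some (.inr (prev j))) := by
  have := adj_next hm (prev j)
  rw [next_prev] at this
  exact this.symm

/-- The weight of the strategy through the `i`-th spoke: `4` on the spoke vertex, `2` on its two
outer neighbors, and `1` on the vertices next to these on the outer cycle. -/
def weight (i : Fin m) : Option (Fin m ⊕ Fin (2 * m)) → ℕ
  | none => 0
  | some (.inl k) => if k = i then 4 else 0
  | some (.inr j) => (if spoke j = i then 2 else 0) + (if spoke (next j) = i then 1 else 0) +
      (if spoke (prev j) = i then 1 else 0)

theorem sum_weight (v : Option (Fin m ⊕ Fin (2 * m))) :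
    ∑ i, weight i v = if v = none then 0 else 4 := by
  rcases v with - | k | j <;> simp [weight, Finset.sum_add_distrib]

theorem exists_adj_two_mul_weight_le (hm : 3 ≤ m) (i : Fin m) (v : Option (Fin m ⊕ Fin (2 * m)))
    (hv : 0 < weight i v) :
    ∃ v', (genPetersen m).Adj v v' ∧ (v' = none ∨ 2 * weight i v ≤ weight i v') := by
  rcases v with - | k | j
  · simp [weight] at hv
  · exact ⟨none, adj_inl_none k, .inl rfl⟩
  have hm' : 2 ≤ m := by omega
  have hnext := spoke_next_ne hm' j
  have hprev := spoke_prev_ne hm' j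
  have hnp := spoke_next_ne_spoke_prev hm j
  by_cases h : spoke j = i
  · subst h
    exact ⟨_, adj_inr_spoke j, .inr (by simp [weight, hnext, hprev])⟩
  by_cases h₁ : spoke (next j) = i
  · subst h₁
    refine ⟨_, adj_next hm' j, .inr ?_⟩
    simp only [weight, if_neg h, if_neg hnp.symm, if_true]
    omega
  by_cases h₂ : spoke (prev j) = i
  · subst h₂
    refine ⟨_, adj_prev hm' j, .inr ?_⟩
    simp only [weight, if_neg h, if_neg hnp, if_true]
    omega
  simp [weight, h, h₁, h₂] at hv

theorem pebblingSolvable_none (hm : 3 ≤ m) (C : Option (Fin m ⊕ Fin (2 * m)) → ℕ)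
    (hC : ∑ v, C v = 3 * m + 1) : PebblingSolvable (genPetersen m) none C := by
  rcases Nat.eq_zero_or_pos (C none) with h0 | h0
  swap
  · exact ⟨C, .refl, h0⟩
  have hones : ∑ i : Fin m, ∑ v, weight i v = 4 * (3 * m) := by
    rw [Finset.sum_comm]
    simp only [sum_weight, Fintype.sum_option, Fintype.sum_sum_type]
    simp
    ring
  have hconf : ∑ i : Fin m, ∑ v, weight i v * C v = 4 * ∑ v, C v := by
    rw [Finset.sum_comm, Finset.mul_sum]
    refine Finset.sum_congr rfl fun v _ ↦ ?_
    rw [← Finset.sum_mul, sum_weight]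
    split_ifs with h
    · simp [h, h0]
    · rfl
  obtain ⟨i, -, hi⟩ := Finset.exists_lt_of_sum_lt (s := (univ : Finset (Fin m)))
    (f := fun i ↦ ∑ v, weight i v) (g := fun i ↦ ∑ v, weight i v * C v)
    (by rw [hones, hconf]; omega)
  exact pebblingSolvable_of_sum_weight_lt (w := weight i) rfl (exists_adj_two_mul_weight_le hm i) C hi

end genPetersen

/-- For `m ≥ 4`, `π(P_{m,2}, u) = 3m + 1 = n(P_{m,2})`, where `u` is the hub. -/
theorem genPetersen_hub_piVertex (m : ℕ) (hm : 4 ≤ m) :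
    piVertex (genPetersen m) none = 3 * m + 1 := by
  refine IsLeast.csInf_eq ⟨genPetersen.pebblingSolvable_none (by omega), fun t ht ↦ ?_⟩
  have := card_le_of_forall_pebblingSolvable ht
  simp only [Fintype.card_option, Fintype.card_sum, Fintype.card_fin] at this
  omega
end

section
/- For every m ≥ 4, the generalized Petersen graph P_{m,2}, which has n = 3m+1 vertices, satisfies π(P_{m,2}, a_0) ≤ n + 5 = 3m + 6 for the spoke vertex a_0, and π(P_{m,2}, b_0) ≤ n + 17 = 3m + 18 for the outer vertex b_0. -/
open Finset SimpleGraph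

variable {V : Type*}

/-- A weighting witnessing the weight function bound for the root `r`: every vertex of positive
weight is adjacent either to `r` or to a vertex of at least twice its weight. -/
def IsPebblingWeight (G : SimpleGraph V) (r : V) (w : V → ℕ) : Prop :=
  ∀ v, 0 < w v → G.Adj v r ∨ ∃ p, G.Adj v p ∧ 2 * w v ≤ w p

theorem PebblingSolvable.of_move {G : SimpleGraph V} {r : V} {C C' : V → ℕ}
    (h : PebblingMove G C C') (h' : PebblingSolvable G r C') : PebblingSolvable G r C := by
  obtain ⟨D, hD, hr⟩ := h'
  exact ⟨D, .head h hD, hr⟩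

open Classical in
/-- Moving along an edge `v ~ p` yields a configuration in which `p` is occupied, and any sum
of weighted pebbles changes by `w p - 2 * w v`. -/
theorem exists_pebblingMove [Fintype V] {G : SimpleGraph V} {C : V → ℕ} {v p : V}
    (h : G.Adj v p) (hv : 2 ≤ C v) :
    ∃ C', PebblingMove G C C' ∧ 1 ≤ C' p ∧
      ∀ w : V → ℕ, ∑ x, w x * C' x + 2 * w v = ∑ x, w x * C x + w p := by
  have hne := h.ne
  refine ⟨fun x => if x = v then C v - 2 else if x = p then C p + 1 else C x,
    ⟨v, p, h, hv, by simp, by simp [hne.symm], fun x h1 h2 => by simp [h1, h2]⟩,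
    by simp [hne.symm], fun w => ?_⟩
  have key : ∑ x, (w x * (if x = v then C v - 2 else if x = p then C p + 1 else C x) +
        if x = v then 2 * w v else 0) = ∑ x, (w x * C x + if x = p then w p else 0) := by
    refine Finset.sum_congr rfl fun x _ => ?_
    by_cases h1 : x = v
    · subst h1
      obtain ⟨c, hc⟩ := Nat.exists_eq_add_of_le hv
      simp only [if_true, if_neg hne, hc, Nat.add_sub_cancel_left]
      ring
    · by_cases h2 : x = p
      · subst h2
        simp only [if_neg h1, if_true]
        ring
      · simp [h1, h2]
  simpa [Finset.sum_add_distrib] using key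

/-- The weight function lemma. -/
theorem IsPebblingWeight.solvable [Fintype V] {G : SimpleGraph V} {r : V} {w : V → ℕ}
    (hw : IsPebblingWeight G r w) {C : V → ℕ} (hC : ∑ v, w v < ∑ v, w v * C v) :
    PebblingSolvable G r C := by
  induction hn : ∑ v, C v using Nat.strong_induction_on generalizing C with
  | _ n ih =>
    obtain ⟨v, -, hv⟩ := Finset.exists_lt_of_sum_lt hC
    have hpos : 0 < w v := Nat.pos_of_ne_zero fun h => by simp [h] at hv
    have htwo : 2 ≤ C v := by
      by_contra! h
      exact absurd hv (not_lt.2 (by simpa using Nat.mul_le_mul_left (w v) (Nat.le_of_lt_succ h)))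
    rcases hw v hpos with h | ⟨p, h, hp⟩
    · obtain ⟨C', hmove, hr, -⟩ := exists_pebblingMove h htwo
      exact ⟨C', .single hmove, hr⟩
    · obtain ⟨C', hmove, -, hsum⟩ := exists_pebblingMove h htwo
      have hweight := hsum w
      have hsize := hsum fun _ => 1
      simp only [one_mul] at hsize
      exact .of_move hmove (ih (∑ x, C' x) (by omega) (by omega) rfl)

/-- A family of weightings with total at least `k` off the root bounds `piVertex`. -/
theorem piVertex_le_of_isPebblingWeight {ι : Type*} [Fintype ι] [Fintype V] {G : SimpleGraph V}
    {r : V} {w : ι → V → ℕ} (hw : ∀ j, IsPebblingWeight G r (w j)) {k t : ℕ}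
    (hk : ∀ v, v ≠ r → k ≤ ∑ j, w j v) (ht : ∑ v, ∑ j, w j v < k * t) :
    piVertex G r ≤ t := by
  refine Nat.sInf_le fun C hC => ?_
  by_contra hns
  have hr : C r = 0 := by
    by_contra h
    exact hns ⟨C, .refl, Nat.pos_of_ne_zero h⟩
  have hle : k * t ≤ ∑ v, ∑ j, w j v * C v := by
    rw [← hC, Finset.mul_sum]
    refine Finset.sum_le_sum fun v _ => ?_
    rw [← Finset.sum_mul]
    rcases eq_or_ne v r with rfl | hv
    · simp [hr]
    · exact Nat.mul_le_mul_right _ (hk v hv)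
  rw [Finset.sum_comm] at hle ht
  have hub : ∑ j, ∑ v, w j v * C v ≤ ∑ j, ∑ v, w j v :=
    Finset.sum_le_sum fun j _ => not_lt.1 fun h => hns ((hw j).solvable h)
  omega

theorem genPetersen_adj_spoke_hub {m : ℕ} (i : Fin m) :
    (genPetersen m).Adj (some (Sum.inl i)) none := by
  simp [genPetersen]

theorem genPetersen_adj_outer_spoke {m : ℕ} (k : Fin (2 * m)) (i : Fin m)
    (h : (k : ℕ) % m = i) :
    (genPetersen m).Adj (some (Sum.inr k)) (some (Sum.inl i)) := by
  have hk : (k : ℕ) = i ∨ (k : ℕ) = m + i := by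
    rcases lt_or_ge (k : ℕ) m with hlt | hge
    · exact .inl (by rwa [Nat.mod_eq_of_lt hlt] at h)
    · rw [Nat.mod_eq_sub_mod hge, Nat.mod_eq_of_lt (by omega)] at h
      omega
  simpa [genPetersen] using hk

theorem genPetersen_adj_outer_outer {m : ℕ} (k l : Fin (2 * m))
    (h : (l : ℕ) = (k + 1) % (2 * m) ∨ (k : ℕ) = (l + 1) % (2 * m)) :
    (genPetersen m).Adj (some (Sum.inr k)) (some (Sum.inr l)) := by
  have hne : k ≠ l := by
    rintro rfl
    have hk := k.isLt
    rcases eq_or_ne ((k : ℕ) + 1) (2 * m) with he | he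
    · simp only [he, Nat.mod_self] at h
      omega
    · rw [Nat.mod_eq_of_lt (by omega)] at h
      omega
  simpa [genPetersen, hne] using h

/-- If `k` lies over a spoke other than the zeroth one, then some neighbour of `k` on the outer
cycle lies over index `k % m - 1` or `k % m + 1` of residue `j`, where an index `m` wraps to `0`. -/
theorem genPetersen_exists_adj_outer {m : ℕ} (hm : 1 ≤ m) (j : Fin 3) (k : Fin (2 * m))
    (h0 : (k : ℕ) % m ≠ 0) (hj : (k : ℕ) % m % 3 ≠ j) :
    ∃ l : Fin (2 * m), (genPetersen m).Adj (some (Sum.inr k)) (some (Sum.inr l)) ∧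
      ((l : ℕ) % m % 3 = j ∨ (l : ℕ) % m = 0 ∧ m % 3 = j) := by
  have hk := k.isLt
  have hlt := Nat.mod_lt (k : ℕ) hm
  have hj3 := j.isLt
  have hdiv := Nat.div_add_mod (k : ℕ) m
  by_cases hpred : ((k : ℕ) % m - 1) % 3 = j
  · have hk0 : (k : ℕ) ≠ 0 := fun h => h0 (by simp [h])
    refine ⟨⟨k - 1, by omega⟩, genPetersen_adj_outer_outer _ _ (.inr ?_), .inl ?_⟩
    · simp only [Nat.sub_add_cancel (Nat.pos_of_ne_zero hk0), Nat.mod_eq_of_lt hk]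
    · have : ((k : ℕ) - 1) % m = k % m - 1 := by
        rw [show (k : ℕ) - 1 = k % m - 1 + m * (k / m) by omega, Nat.add_mul_mod_self_left,
          Nat.mod_eq_of_lt (by omega)]
      simpa only [this]
  · refine ⟨⟨(k + 1) % (2 * m), Nat.mod_lt _ (by omega)⟩,
      genPetersen_adj_outer_outer _ _ (.inl rfl), ?_⟩
    have hsucc : ((k : ℕ) + 1) % (2 * m) % m = (k % m + 1) % m := by
      rw [Nat.mod_mul_left_mod, Nat.mod_add_mod]
    simp only [hsucc]
    rcases eq_or_ne ((k : ℕ) % m + 1) m with he | he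
    · refine .inr ⟨by rw [he, Nat.mod_self], by omega⟩
    · rw [Nat.mod_eq_of_lt (by omega : (k : ℕ) % m + 1 < m)]
      omega

/-- The `j`-th weighting rooted at the spoke vertex `a_0`. -/
def spokeWeight (m : ℕ) (j : Fin 3) : Option (Fin m ⊕ Fin (2 * m)) → ℕ
  | none => 8
  | some (Sum.inl i) => if (i : ℕ) ≠ 0 ∧ (i : ℕ) % 3 = j then 4 else 0
  | some (Sum.inr k) =>
    if (k : ℕ) % m = 0 then (if (j : ℕ) = 0 then 2 else 0) + (if m % 3 = j then 2 else 0)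
    else if (k : ℕ) % m % 3 = j then 2 else 1

/-- The `j`-th weighting rooted at the outer vertex `b_0`. -/
def outerWeight (m : ℕ) (j : Fin 3) : Option (Fin m ⊕ Fin (2 * m)) → ℕ
  | none => 8
  | some (Sum.inl i) => if (i : ℕ) = 0 then 16 else if (i : ℕ) % 3 = j then 4 else 0
  | some (Sum.inr k) =>
    if (k : ℕ) = 0 then 0 else if (k : ℕ) % m = 0 then 2
    else if (k : ℕ) % m % 3 = j then 2 else 1

theorem isPebblingWeight_spokeWeight {m : ℕ} (hm : 0 < m) (j : Fin 3) :
    IsPebblingWeight (genPetersen m) (some (Sum.inl ⟨0, hm⟩)) (spokeWeight m j) := by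
  rintro (_ | i | k) hpos
  · exact .inl (genPetersen_adj_spoke_hub _).symm
  · refine .inr ⟨none, genPetersen_adj_spoke_hub i, ?_⟩
    simp only [spokeWeight]
    split_ifs <;> omega
  · by_cases h0 : (k : ℕ) % m = 0
    · exact .inl (genPetersen_adj_outer_spoke _ _ h0)
    right
    by_cases hj : (k : ℕ) % m % 3 = j
    · exact ⟨_, genPetersen_adj_outer_spoke k ⟨k % m, Nat.mod_lt _ hm⟩ rfl,
        by simp [spokeWeight, h0, hj]⟩
    · obtain ⟨l, hadj, hl⟩ := genPetersen_exists_adj_outer hm j k h0 hj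
      refine ⟨_, hadj, ?_⟩
      simp only [spokeWeight, h0, hj, if_false]
      split_ifs <;> omega

theorem isPebblingWeight_outerWeight {m : ℕ} (hm : 0 < m) (j : Fin 3) :
    IsPebblingWeight (genPetersen m) (some (Sum.inr ⟨0, by omega⟩)) (outerWeight m j) := by
  rintro (_ | i | k) hpos
  · exact .inr ⟨_, (genPetersen_adj_spoke_hub ⟨0, hm⟩).symm, by simp [outerWeight]⟩
  · by_cases h0 : (i : ℕ) = 0
    · exact .inl (genPetersen_adj_outer_spoke _ _ (by simp [h0])).symm
    · refine .inr ⟨none, genPetersen_adj_spoke_hub i, ?_⟩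
      simp only [outerWeight, h0, if_false]
      split_ifs <;> omega
  · have hk0 : (k : ℕ) ≠ 0 := fun h => by simp [outerWeight, h] at hpos
    by_cases h0 : (k : ℕ) % m = 0
    · exact .inr ⟨_, genPetersen_adj_outer_spoke k ⟨0, hm⟩ h0, by simp [outerWeight, hk0, h0]⟩
    by_cases hj : (k : ℕ) % m % 3 = j
    · exact .inr ⟨_, genPetersen_adj_outer_spoke k ⟨k % m, Nat.mod_lt _ hm⟩ rfl,
        by simp [outerWeight, hk0, h0, hj]⟩
    · obtain ⟨l, hadj, hl⟩ := genPetersen_exists_adj_outer hm j k h0 hj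
      by_cases hl0 : (l : ℕ) = 0
      · have hl_root : l = ⟨0, by omega⟩ := Fin.ext hl0
        exact .inl (hl_root ▸ hadj)
      · refine .inr ⟨_, hadj, ?_⟩
        simp only [outerWeight, hk0, h0, hj, hl0, if_false]
        split_ifs <;> omega

theorem sum_spokeWeight {m : ℕ} (hm : 0 < m) (v : Option (Fin m ⊕ Fin (2 * m))) :
    ∑ j, spokeWeight m j v + (if v = some (Sum.inl ⟨0, hm⟩) then 4 else 0) =
      4 + if v = none then 20 else 0 := by
  rcases v with _ | i | k
  · simp [spokeWeight]
  · simp only [spokeWeight, Fin.sum_univ_three, Option.some.injEq, Sum.inl.injEq, Fin.ext_iff,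
      Fin.val_zero, Fin.val_one, Fin.val_two, reduceCtorEq, if_false]
    split_ifs <;> omega
  · simp only [spokeWeight, Fin.sum_univ_three, Option.some.injEq, reduceCtorEq, if_false,
      Fin.val_zero, Fin.val_one, Fin.val_two]
    split_ifs <;> omega

theorem sum_outerWeight {m : ℕ} (hm : 0 < m) (v : Option (Fin m ⊕ Fin (2 * m))) :
    ∑ j, outerWeight m j v + (if v = some (Sum.inr ⟨0, by omega⟩) then 4 else 0) =
      4 + (if v = none then 20 else 0) + (if v = some (Sum.inl ⟨0, hm⟩) then 44 else 0) +
        if v = some (Sum.inr ⟨m, by omega⟩) then 2 else 0 := by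
  rcases v with _ | i | k
  · simp [outerWeight]
  · simp only [outerWeight, Fin.sum_univ_three, Option.some.injEq, Sum.inl.injEq, Fin.ext_iff,
      Fin.val_zero, Fin.val_one, Fin.val_two, reduceCtorEq, if_false]
    split_ifs <;> omega
  · have hk : (k : ℕ) % m = 0 ↔ (k : ℕ) = 0 ∨ (k : ℕ) = m := by
      refine ⟨fun h => ?_, by rintro (h | h) <;> simp [h]⟩
      obtain ⟨c, hc⟩ := Nat.dvd_of_mod_eq_zero h
      have hlt : c < 2 := by
        have := k.isLt
        rw [hc, mul_comm] at this
        exact lt_of_mul_lt_mul_right this m.zero_le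
      interval_cases c <;> omega
    simp only [outerWeight, Fin.sum_univ_three, Option.some.injEq, Sum.inr.injEq, Fin.ext_iff,
      Fin.val_zero, Fin.val_one, Fin.val_two, reduceCtorEq, if_false]
    split_ifs <;> omega

/-- For `m ≥ 4`, `π(P_{m,2}, a_0) ≤ n + 5 = 3m + 6` for the spoke vertex `a_0`,
and `π(P_{m,2}, b_0) ≤ n + 17 = 3m + 18` for the outer vertex `b_0`. -/
theorem genPetersen_spoke_outer_piVertex_le (m : ℕ) (hm : 4 ≤ m) :
    piVertex (genPetersen m) (some (Sum.inl ⟨0, by omega⟩)) ≤ 3 * m + 6 ∧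
    piVertex (genPetersen m) (some (Sum.inr ⟨0, by omega⟩)) ≤ 3 * m + 18 := by
  have hm0 : 0 < m := by omega
  constructor
  · refine piVertex_le_of_isPebblingWeight (k := 4) (isPebblingWeight_spokeWeight hm0)
      (fun v hv => ?_) ?_
    · have := sum_spokeWeight hm0 v
      rw [if_neg hv] at this
      omega
    · have := Finset.sum_congr rfl fun v (_ : v ∈ univ) => sum_spokeWeight hm0 v
      simp only [Finset.sum_add_distrib, Finset.sum_ite_eq', Finset.mem_univ, if_true,
        Finset.sum_const, Finset.card_univ, Fintype.card_option, Fintype.card_sum,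
        Fintype.card_fin, smul_eq_mul] at this
      omega
  · refine piVertex_le_of_isPebblingWeight (k := 4) (isPebblingWeight_outerWeight hm0)
      (fun v hv => ?_) ?_
    · have := sum_outerWeight hm0 v
      rw [if_neg hv] at this
      omega
    · have := Finset.sum_congr rfl fun v (_ : v ∈ univ) => sum_outerWeight hm0 v
      simp only [Finset.sum_add_distrib, Finset.sum_ite_eq', Finset.mem_univ, if_true,
        Finset.sum_const, Finset.card_univ, Fintype.card_option, Fintype.card_sum,
        Fintype.card_fin, smul_eq_mul] at this
      omega
end
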